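/- arXiv:0806.3366 — 2 statements merged into one kernel-verified Lean document; each statement's English description precedes it below -/
import Mathlib

section
/- Let Ω ⊂ ℝ² be a closed polygon. Then there exist ε₀ > 0, θ ∈ (0, π/3], and d ∈ (0, 1) such that for every ε with 0 < ε ≤ ε₀ there exists a triangulation L of Ω satisfying sin φ ≥ sin θ for every angle φ of every triangular face of L, and d·ε ≤ |e| ≤ ε for every edge e of L. -/
open Set Geometry EuclideanGeometry Metric Real

noncomputable section

abbrev E2 : Type := EuclideanSpace ℝ (Fin 2)

/-- The set of Hölder ratios of exponent `α` of `u` on `S`. -/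
def holderRatioSet (α : ℝ) (S : Set E2) (u : E2 → E2) : Set ℝ :=
  {c | ∃ x ∈ S, ∃ y ∈ S, x ≠ y ∧ c = ‖u x - u y‖ / ‖x - y‖ ^ α}

/-- The Hölder seminorm of exponent `α` of `u` on `S`. -/
def holderSeminorm (α : ℝ) (S : Set E2) (u : E2 → E2) : ℝ :=
  sSup (holderRatioSet α S u)

/-- The supremum norm of `u` on `S`. -/
def supNorm (S : Set E2) (u : E2 → E2) : ℝ :=
  sSup ((fun x => ‖u x‖) '' S)

/-- `f` is a homeomorphism of `S` onto its image `f '' S`. -/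
def IsHomeoOn (f : E2 → E2) (S : Set E2) : Prop :=
  ContinuousOn f S ∧ Set.InjOn f S ∧ ContinuousOn (Function.invFunOn f S) (f '' S)

/-- `K` is a triangulation of `Ω`. -/
def IsTriangulation (K : SimplicialComplex ℝ E2) (Ω : Set E2) : Prop :=
  K.faces.Finite ∧ (∀ s ∈ K.faces, s.card ≤ 3) ∧ K.space = Ω ∧
    ∀ s ∈ K.faces, ∃ t ∈ K.faces, s ⊆ t ∧ t.card = 3

/-- A closed polygon: a compact set admitting a triangulation. -/
def IsClosedPolygon (Ω : Set E2) : Prop :=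
  IsCompact Ω ∧ ∃ K : SimplicialComplex ℝ E2, IsTriangulation K Ω

/-- `f` is piecewise affine over the simplicial complex `K`. -/
def PiecewiseAffineOn (f : E2 → E2) (K : SimplicialComplex ℝ E2) : Prop :=
  ∀ s ∈ K.faces, ∃ A : E2 →ᵃ[ℝ] E2, ∀ x ∈ convexHull ℝ (s : Set E2), f x = A x

/-- Every angle of every triangular face of `K` has sine at least `c`. -/
def AngleLB (K : SimplicialComplex ℝ E2) (c : ℝ) : Prop :=
  ∀ s ∈ K.faces, ∀ p ∈ s, ∀ q ∈ s, ∀ r ∈ s,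
    p ≠ q → q ≠ r → p ≠ r → c ≤ Real.sin (∠ p q r)

/-- Length of an edge (a two-element face). -/
def edgeLen (e : Finset E2) : ℝ := Metric.diam (e : Set E2)

/-- `o` is the incenter of the triangle `p₁p₂p₃` with inradius `r`. -/
def IsIncenter (p₁ p₂ p₃ o : E2) (r : ℝ) : Prop :=
  o ∈ interior (convexHull ℝ {p₁, p₂, p₃}) ∧
  Metric.infDist o (affineSpan ℝ ({p₁, p₂} : Set E2) : Set E2) = r ∧
  Metric.infDist o (affineSpan ℝ ({p₂, p₃} : Set E2) : Set E2) = r ∧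
  Metric.infDist o (affineSpan ℝ ({p₃, p₁} : Set E2) : Set E2) = r


section Subdivision

variable {E : Type*} [AddCommGroup E] [Module ℝ E]

/-- The linear combination of the vertices of an ordered triangle. -/
def triComb (t : E × E × E) (x y z : ℝ) : E := x • t.1 + y • t.2.1 + z • t.2.2

/-- The finitely supported weight attached to the vertices of an ordered triangle. -/
def triWeight (t : E × E × E) (x y z : ℝ) : E →₀ ℝ :=
  Finsupp.single t.1 x + Finsupp.single t.2.1 y + Finsupp.single t.2.2 z

open Classical in
/-- The vertex set of an ordered triangle. -/
def triVerts (t : E × E × E) : Finset E := {t.1, t.2.1, t.2.2}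

/-- The vertices of an ordered triangle are affinely independent. -/
def TriNondeg (t : E × E × E) : Prop :=
  ∀ x y z : ℝ, x + y + z = 0 → triComb t x y z = 0 → x = 0 ∧ y = 0 ∧ z = 0

/-- Three reals form a convex weight. -/
def ConvWeight (x y z : ℝ) : Prop := 0 ≤ x ∧ 0 ≤ y ∧ 0 ≤ z ∧ x + y + z = 1

/-- The union of a family of triangles. -/
def triSpace (T : Set (E × E × E)) : Set E :=
  {p | ∃ t ∈ T, ∃ x y z, ConvWeight x y z ∧ triComb t x y z = p}

/-- A finite family of nondegenerate triangles in which every point has unique barycentric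
coordinates. -/
structure IsTriFamily (T : Set (E × E × E)) : Prop where
  finite : T.Finite
  nondeg : ∀ t ∈ T, TriNondeg t
  weight_eq : ∀ t ∈ T, ∀ t' ∈ T, ∀ x y z x' y' z', ConvWeight x y z → ConvWeight x' y' z' →
    triComb t x y z = triComb t' x' y' z' → triWeight t x y z = triWeight t' x' y' z'

/-- The second triangle is the image of the first one under a homothety of ratio `k` followed by a translation. -/
def TriHomothetic (k : ℝ) (t t' : E × E × E) : Prop :=
  t'.2.1 - t'.1 = k • (t.2.1 - t.1) ∧ t'.2.2 - t'.1 = k • (t.2.2 - t.1)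

lemma TriHomothetic.trans {k l : ℝ} {t t' t'' : E × E × E} (h : TriHomothetic k t t')
    (h' : TriHomothetic l t' t'') : TriHomothetic (l * k) t t'' := by
  refine ⟨?_, ?_⟩
  · rw [h'.1, h.1, smul_smul]
  · rw [h'.2, h.2, smul_smul]

lemma TriHomothetic.rotate {k : ℝ} {a b c p q r : E} (h : TriHomothetic k (a, b, c) (p, q, r)) :
    TriHomothetic k (b, c, a) (q, r, p) := by
  obtain ⟨h1, h2⟩ := h
  simp only at h1 h2
  refine ⟨?_, ?_⟩ <;> simp only
  · rw [← sub_sub_sub_cancel_right r q p, h1, h2]; module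
  · rw [← neg_sub, h1]; module

lemma TriHomothetic.swap {k : ℝ} {a b c p q r : E} (h : TriHomothetic k (a, b, c) (p, q, r)) :
    TriHomothetic k (a, c, b) (p, r, q) := ⟨h.2, h.1⟩

lemma TriNondeg.of_homothetic {k : ℝ} (hk : k ≠ 0) {t t' : E × E × E} (ht : TriNondeg t)
    (h : TriHomothetic k t t') : TriNondeg t' := by
  intro x y z hs h0
  refine ht x y z hs ?_
  obtain ⟨h1, h2⟩ := h
  have hx : x = -y - z := by linarith
  have e : triComb t' x y z = k • triComb t x y z := by
    have : triComb t' x y z = y • (t'.2.1 - t'.1) + z • (t'.2.2 - t'.1) := by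
      rw [triComb, hx]; module
    rw [this, h1, h2, triComb, hx]; module
  rw [e] at h0
  exact (smul_eq_zero.mp h0).resolve_left hk

lemma TriNondeg.distinct {t : E × E × E} (ht : TriNondeg t) :
    t.1 ≠ t.2.1 ∧ t.1 ≠ t.2.2 ∧ t.2.1 ≠ t.2.2 := by
  refine ⟨fun h => ?_, fun h => ?_, fun h => ?_⟩
  · have := ht 1 (-1) 0 (by norm_num) (by rw [triComb, h]; module)
    norm_num at this
  · have := ht 1 0 (-1) (by norm_num) (by rw [triComb, h]; module)
    norm_num at this
  · have := ht 0 1 (-1) (by norm_num) (by rw [triComb, h]; module)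
    norm_num at this

lemma TriNondeg.card_triVerts {t : E × E × E} (ht : TriNondeg t) : (triVerts t).card = 3 := by
  obtain ⟨h1, h2, h3⟩ := ht.distinct
  classical
  rw [Finset.card_eq_three]
  exact ⟨_, _, _, h1, h2, h3, by simp [triVerts]⟩

lemma TriNondeg.affineIndependent {t : E × E × E} (ht : TriNondeg t) :
    AffineIndependent ℝ ((↑) : triVerts t → E) := by
  have h : AffineIndependent ℝ ![t.1, t.2.1, t.2.2] := by
    rw [affineIndependent_iff_of_fintype]
    intro w hw h0
    rw [Finset.univ.weightedVSub_eq_linear_combination hw] at h0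
    simp only [Fin.sum_univ_three] at hw h0
    have := ht (w 0) (w 1) (w 2) hw (by simpa [triComb] using h0)
    intro i
    fin_cases i
    · exact this.1
    · exact this.2.1
    · exact this.2.2
  have h' := h.range
  refine h'.mono ?_
  intro v hv
  simp only [triVerts, Finset.coe_insert, Finset.coe_singleton, Set.mem_insert_iff,
    Set.mem_singleton_iff] at hv
  rcases hv with rfl | rfl | rfl
  · exact ⟨0, rfl⟩
  · exact ⟨1, rfl⟩
  · exact ⟨2, rfl⟩

lemma triNondeg_of_affineIndependent {a b c : E} (hab : a ≠ b) (hac : a ≠ c) (hbc : b ≠ c)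
    (h : AffineIndependent ℝ ((↑) : triVerts (a, b, c) → E)) : TriNondeg (a, b, c) := by
  intro x y z hs h0
  classical
  rw [affineIndependent_iff_of_fintype] at h
  let w : E → ℝ := fun v => if v = a then x else if v = b then y else z
  have wa : w a = x := by simp [w]
  have wb : w b = y := by simp [w, hab.symm]
  have wc : w c = z := by simp [w, hac.symm, hbc.symm]
  have hw : ∑ i : triVerts (a, b, c), w i = 0 := by
    rw [Finset.sum_coe_sort (triVerts (a, b, c)) w]
    simp [triVerts, hab, hac, hbc, wa, wb, wc]
    linarith
  have := h (fun i => w i) hw (by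
    rw [Finset.univ.weightedVSub_eq_linear_combination hw,
      Finset.sum_coe_sort (triVerts (a, b, c)) (fun v => w v • v)]
    simp only [triComb] at h0
    simp [triVerts, hab, hac, hbc, wa, wb, wc, ← h0, add_assoc])
  refine ⟨?_, ?_, ?_⟩
  · rw [← wa]; exact this ⟨a, by simp [triVerts]⟩
  · rw [← wb]; exact this ⟨b, by simp [triVerts]⟩
  · rw [← wc]; exact this ⟨c, by simp [triVerts]⟩

lemma triWeight_coe {t : E × E × E} (ht : TriNondeg t) (u : E → ℝ)
    (hu : ∀ v, v ∉ triVerts t → u v = 0) :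
    ⇑(triWeight t (u t.1) (u t.2.1) (u t.2.2)) = u := by
  classical
  obtain ⟨h1, h2, h3⟩ := ht.distinct
  ext v
  by_cases hv : v ∈ triVerts t
  · simp only [triVerts, Finset.mem_insert, Finset.mem_singleton] at hv
    rcases hv with rfl | rfl | rfl <;>
      simp [triWeight, h1, h2, h3, h1.symm, h2.symm, h3.symm]
  · rw [hu v hv]
    simp only [triVerts, Finset.mem_insert, Finset.mem_singleton, not_or] at hv
    simp [triWeight, Ne.symm hv.1, Ne.symm hv.2.1, Ne.symm hv.2.2]

lemma exists_weight_of_mem_convexHull {t : E × E × E} (ht : TriNondeg t) {s : Finset E}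
    (hs : s ⊆ triVerts t) {p : E} (hp : p ∈ convexHull ℝ (s : Set E)) :
    ∃ u : E → ℝ, (∀ v, v ∉ s → u v = 0) ∧ (∀ v, 0 ≤ u v) ∧
      ConvWeight (u t.1) (u t.2.1) (u t.2.2) ∧ triComb t (u t.1) (u t.2.1) (u t.2.2) = p := by
  classical
  obtain ⟨h1, h2, h3⟩ := ht.distinct
  obtain ⟨w, hw, hsum, hc⟩ := Finset.mem_convexHull'.mp hp
  let u : E → ℝ := fun v => if v ∈ s then w v else 0
  have hu : ∀ v, v ∉ s → u v = 0 := fun v hv => by simp [u, hv]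
  have hu0 : ∀ v, 0 ≤ u v := fun v => by
    by_cases hv : v ∈ s
    · simpa [u, hv] using hw v hv
    · simp [u, hv]
  have e1 : ∑ v ∈ triVerts t, u v = 1 := by
    rw [← Finset.sum_subset hs (fun v _ hv => hu v hv), ← hsum]
    exact Finset.sum_congr rfl fun v hv => by simp [u, hv]
  have e2 : ∑ v ∈ triVerts t, u v • v = p := by
    rw [← Finset.sum_subset hs (fun v _ hv => by rw [hu v hv, zero_smul]), ← hc]
    exact Finset.sum_congr rfl fun v hv => by simp [u, hv]
  refine ⟨u, hu, hu0, ⟨hu0 _, hu0 _, hu0 _, ?_⟩, ?_⟩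
  · rw [← e1]; simp [triVerts, h1, h2, h3, add_assoc]
  · rw [← e2]; simp [triVerts, triComb, h1, h2, h3, add_assoc]

lemma triComb_mem_convexHull (t : E × E × E) {x y z : ℝ} (h : ConvWeight x y z) :
    triComb t x y z ∈ convexHull ℝ (triVerts t : Set E) := by
  obtain ⟨hx, hy, hz, hs⟩ := h
  have hc := convex_convexHull ℝ (triVerts t : Set E)
  have h1 : t.1 ∈ convexHull ℝ (triVerts t : Set E) :=
    subset_convexHull ℝ _ (by simp [triVerts])
  have h2 : t.2.1 ∈ convexHull ℝ (triVerts t : Set E) :=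
    subset_convexHull ℝ _ (by simp [triVerts])
  have h3 : t.2.2 ∈ convexHull ℝ (triVerts t : Set E) :=
    subset_convexHull ℝ _ (by simp [triVerts])
  have := hc.sum_mem (t := Finset.univ) (w := ![x, y, z]) (z := ![t.1, t.2.1, t.2.2])
    (by intro i _; fin_cases i <;> simpa) (by simpa [Fin.sum_univ_three] using hs)
    (by intro i _; fin_cases i <;> simpa)
  simpa [Fin.sum_univ_three, triComb] using this

/-- The simplicial complex spanned by a family of triangles. -/
def IsTriFamily.complex {T : Set (E × E × E)} (hT : IsTriFamily T) : SimplicialComplex ℝ E where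
  faces := {s | s.Nonempty ∧ ∃ t ∈ T, s ⊆ triVerts t}
  isRelLowerSet_faces := by
    rintro s ⟨hs, t, ht, hst⟩
    exact ⟨hs, fun s' hs' hne => ⟨hne, t, ht, Finset.Subset.trans hs' hst⟩⟩
  indep := by
    rintro s ⟨-, t, ht, hst⟩
    exact (hT.nondeg t ht).affineIndependent.mono (Finset.coe_subset.mpr hst)
  inter_subset_convexHull := by
    classical
    rintro s s' ⟨-, t, ht, hst⟩ ⟨-, t', ht', hst'⟩ p ⟨hp, hp'⟩
    obtain ⟨u, hu, hu0, huc, hup⟩ := exists_weight_of_mem_convexHull (hT.nondeg t ht) hst hp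
    obtain ⟨u', hu', hu0', huc', hup'⟩ :=
      exists_weight_of_mem_convexHull (hT.nondeg t' ht') hst' hp'
    have key := hT.weight_eq t ht t' ht' _ _ _ _ _ _ huc huc' (hup.trans hup'.symm)
    have heq : u = u' := by
      rw [← triWeight_coe (hT.nondeg t ht) u (fun v hv => hu v fun h => hv (hst h)),
        ← triWeight_coe (hT.nondeg t' ht') u' (fun v hv => hu' v fun h => hv (hst' h)), key]
    obtain ⟨h1, h2, h3⟩ := (hT.nondeg t ht).distinct
    have hz : ∀ v, v ∉ s ∩ s' → u v = 0 := by
      intro v hv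
      by_cases hvs : v ∈ s
      · rw [heq]
        exact hu' v fun h => hv (Finset.mem_inter.mpr ⟨hvs, h⟩)
      · exact hu v hvs
    have hsub : s ∩ s' ⊆ triVerts t := Finset.inter_subset_left.trans hst
    rw [← Finset.coe_inter, Finset.mem_convexHull']
    refine ⟨u, fun v _ => hu0 v, ?_, ?_⟩
    · rw [Finset.sum_subset hsub (fun v _ hv => hz v hv), ← huc.2.2.2]
      simp [triVerts, h1, h2, h3, add_assoc]
    · rw [Finset.sum_subset hsub (fun v _ hv => by rw [hz v hv, zero_smul]), ← hup]
      simp [triVerts, triComb, h1, h2, h3, add_assoc]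

lemma triVerts_nonempty {α : Type*} (t : α × α × α) : (triVerts t).Nonempty := ⟨t.1, by simp [triVerts]⟩

lemma IsTriFamily.complex_space {T : Set (E × E × E)} (hT : IsTriFamily T) :
    hT.complex.space = triSpace T := by
  ext p
  rw [SimplicialComplex.mem_space_iff]
  constructor
  · rintro ⟨s, ⟨-, t, ht, hst⟩, hp⟩
    obtain ⟨u, -, -, huc, hup⟩ := exists_weight_of_mem_convexHull (hT.nondeg t ht) hst hp
    exact ⟨t, ht, _, _, _, huc, hup⟩
  · rintro ⟨t, ht, x, y, z, hw, rfl⟩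
    exact ⟨triVerts t, ⟨triVerts_nonempty t, t, ht, Finset.Subset.refl _⟩,
      triComb_mem_convexHull t hw⟩

lemma IsTriFamily.complex_faces_finite {T : Set (E × E × E)} (hT : IsTriFamily T) :
    hT.complex.faces.Finite := by
  refine (hT.finite.biUnion fun t _ => (triVerts t).powerset.finite_toSet).subset ?_
  rintro s ⟨-, t, ht, hst⟩
  exact Set.mem_biUnion ht (by simpa using hst)

/-- The ordered triangles of a simplicial complex. -/
def orderedTriangles (K : SimplicialComplex ℝ E) : Set (E × E × E) :=
  {t | triVerts t ∈ K.faces ∧ t.1 ≠ t.2.1 ∧ t.1 ≠ t.2.2 ∧ t.2.1 ≠ t.2.2}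

lemma nondeg_of_mem_orderedTriangles {K : SimplicialComplex ℝ E} {t : E × E × E}
    (ht : t ∈ orderedTriangles K) : TriNondeg t :=
  triNondeg_of_affineIndependent ht.2.1 ht.2.2.1 ht.2.2.2 (K.indep ht.1)

lemma TriNondeg.weight_unique {t : E × E × E} (ht : TriNondeg t) {x y z x' y' z' : ℝ}
    (h : ConvWeight x y z) (h' : ConvWeight x' y' z')
    (hc : triComb t x y z = triComb t x' y' z') : x = x' ∧ y = y' ∧ z = z' := by
  have := ht (x - x') (y - y') (z - z') (by linarith [h.2.2.2, h'.2.2.2]) (by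
    have e : triComb t (x - x') (y - y') (z - z') = triComb t x y z - triComb t x' y' z' := by
      simp only [triComb]; module
    rw [e, hc, sub_self])
  exact ⟨by linarith [this.1], by linarith [this.2.1], by linarith [this.2.2]⟩

lemma isTriFamily_orderedTriangles {K : SimplicialComplex ℝ E} (hK : K.faces.Finite) :
    IsTriFamily (orderedTriangles K) where
  finite := by
    have hV : (⋃ s ∈ K.faces, (s : Set E)).Finite := hK.biUnion fun s _ => s.finite_toSet
    refine (hV.prod (hV.prod hV)).subset ?_
    intro t ht
    refine ⟨?_, ?_, ?_⟩ <;> exact Set.mem_biUnion ht.1 (by simp [triVerts])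
  nondeg t ht := nondeg_of_mem_orderedTriangles ht
  weight_eq := by
    classical
    intro t ht t' ht' x y z x' y' z' h h' hc
    have nt := nondeg_of_mem_orderedTriangles ht
    have nt' := nondeg_of_mem_orderedTriangles ht'
    have hp := K.inter_subset_convexHull ht.1 ht'.1
      ⟨triComb_mem_convexHull t h, hc ▸ triComb_mem_convexHull t' h'⟩
    rw [← Finset.coe_inter] at hp
    obtain ⟨w, hw, hw1, hwp⟩ := Finset.mem_convexHull'.mp hp
    let u : E → ℝ := fun v => if v ∈ triVerts t ∩ triVerts t' then w v else 0
    have hu : ∀ v, v ∉ triVerts t ∩ triVerts t' → u v = 0 := fun v hv => if_neg hv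
    have hu0 : ∀ v, 0 ≤ u v := fun v => by
      by_cases hv : v ∈ triVerts t ∩ triVerts t'
      · simpa only [u, if_pos hv] using hw v hv
      · exact (hu v hv).ge
    have hu1 : ∑ v ∈ triVerts t ∩ triVerts t', u v = 1 := by
      rw [← hw1]; exact Finset.sum_congr rfl fun v hv => if_pos hv
    have hup : ∑ v ∈ triVerts t ∩ triVerts t', u v • v = triComb t x y z := by
      rw [← hwp]; exact Finset.sum_congr rfl fun v hv => by simp only [u, if_pos hv]
    have main : ∀ (r : E × E × E), TriNondeg r → triVerts t ∩ triVerts t' ⊆ triVerts r →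
        ∀ a b c, ConvWeight a b c → triComb r a b c = triComb t x y z →
        ⇑(triWeight r a b c) = u := by
      intro r hr hsub a b c habc hcomb
      obtain ⟨h1, h2, h3⟩ := hr.distinct
      have e1 : u r.1 + u r.2.1 + u r.2.2 = 1 := by
        rw [← hu1, Finset.sum_subset hsub (fun v _ hv => hu v hv)]
        simp [triVerts, h1, h2, h3, add_assoc]
      have e2 : triComb r (u r.1) (u r.2.1) (u r.2.2) = triComb t x y z := by
        rw [← hup, Finset.sum_subset hsub (fun v _ hv => by rw [hu v hv, zero_smul])]
        simp [triVerts, triComb, h1, h2, h3, add_assoc]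
      obtain ⟨rfl, rfl, rfl⟩ := hr.weight_unique habc ⟨hu0 _, hu0 _, hu0 _, e1⟩
        (hcomb.trans e2.symm)
      exact triWeight_coe hr u fun v hv => hu v fun hv' => hv (hsub hv')
    apply DFunLike.coe_injective
    rw [main t nt Finset.inter_subset_left x y z h rfl,
      main t' nt' Finset.inter_subset_right x' y' z' h' hc.symm]

/-- The midpoint of two points of a real vector space. -/
def half (u v : E) : E := (2⁻¹ : ℝ) • (u + v)

lemma half_self (u : E) : half u u = u := by rw [half]; module

lemma half_comm (u v : E) : half u v = half v u := by rw [half, half, add_comm]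

/-- The four triangles of the midpoint subdivision of a triangle. -/
def triChildren (t : E × E × E) : Set (E × E × E) :=
  {(t.1, half t.1 t.2.1, half t.1 t.2.2), (half t.1 t.2.1, t.2.1, half t.2.1 t.2.2),
    (half t.1 t.2.2, half t.2.1 t.2.2, t.2.2),
    (half t.2.1 t.2.2, half t.1 t.2.2, half t.1 t.2.1)}

/-- The midpoint subdivision of a family of triangles. -/
def triSubdivision (T : Set (E × E × E)) : Set (E × E × E) := ⋃ t ∈ T, triChildren t

open Classical in
/-- Half of the coefficient (the full one on the diagonal) at the midpoint of `u` and `v` after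
midpoint subdivision of a point with barycentric coordinates `f`. -/
def midCoeff (f : E →₀ ℝ) (u v : E) : ℝ :=
  if u = v then max 0 (2 * f u - 1)
  else 2⁻¹ * min (2 * f u) (min (2 * f v) (max 0 (2 * (f u + f v) - 1)))

/-- The barycentric coordinates in the midpoint subdivision of a point with barycentric
coordinates `f`. -/
def midWeight (f : E →₀ ℝ) : E →₀ ℝ :=
  ∑ u ∈ f.support, ∑ v ∈ f.support, Finsupp.single (half u v) (midCoeff f u v)

lemma midCoeff_eq_zero_left {α : Type*} {f : α →₀ ℝ} {u v : α} (hv : 0 ≤ f v) (h : f u = 0) :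
    midCoeff f u v = 0 := by
  unfold midCoeff
  split_ifs
  · simp [h]
  · rw [h, mul_zero, min_eq_left (le_min (by linarith) (le_max_left _ _)), mul_zero]

lemma midCoeff_comm {α : Type*} (f : α →₀ ℝ) (u v : α) : midCoeff f u v = midCoeff f v u := by
  unfold midCoeff
  by_cases h : u = v
  · simp [h]
  · rw [if_neg h, if_neg (Ne.symm h), min_left_comm, add_comm (f u)]

lemma midWeight_triWeight {a b c : E} (hab : a ≠ b) (hac : a ≠ c) (hbc : b ≠ c) {x y z : ℝ}
    (h : ConvWeight x y z) :
    midWeight (triWeight (a, b, c) x y z) =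
      Finsupp.single a (max 0 (2 * x - 1)) + Finsupp.single b (max 0 (2 * y - 1)) +
      Finsupp.single c (max 0 (2 * z - 1)) +
      Finsupp.single (half a b) (min (2 * x) (min (2 * y) (max 0 (1 - 2 * z)))) +
      Finsupp.single (half a c) (min (2 * x) (min (2 * z) (max 0 (1 - 2 * y)))) +
      Finsupp.single (half b c) (min (2 * y) (min (2 * z) (max 0 (1 - 2 * x)))) := by
  classical
  obtain ⟨hx, hy, hz, hs⟩ := h
  set f := triWeight (a, b, c) x y z with hf
  have fa : f a = x := by simp [hf, triWeight, hab.symm, hac.symm]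
  have fb : f b = y := by simp [hf, triWeight, hab, hbc.symm]
  have fc : f c = z := by simp [hf, triWeight, hac, hbc]
  have f0 : ∀ v, v ∉ ({a, b, c} : Finset E) → f v = 0 := by
    intro v hv
    simp only [Finset.mem_insert, Finset.mem_singleton, not_or] at hv
    simp [hf, triWeight, Ne.symm hv.1, Ne.symm hv.2.1, Ne.symm hv.2.2]
  have fnn : ∀ v, 0 ≤ f v := by
    intro v
    by_cases hv : v ∈ ({a, b, c} : Finset E)
    · simp only [Finset.mem_insert, Finset.mem_singleton] at hv
      rcases hv with rfl | rfl | rfl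
      · rwa [fa]
      · rwa [fb]
      · rwa [fc]
    · rw [f0 v hv]
  have hsub : f.support ⊆ {a, b, c} := by
    intro v hv
    by_contra hv'
    exact (Finsupp.mem_support_iff.mp hv) (f0 v hv')
  have e : midWeight f = ∑ u ∈ ({a, b, c} : Finset E), ∑ v ∈ ({a, b, c} : Finset E),
      Finsupp.single (half u v) (midCoeff f u v) := by
    unfold midWeight
    have inner : ∀ u, ∑ v ∈ f.support, Finsupp.single (half u v) (midCoeff f u v) =
        ∑ v ∈ ({a, b, c} : Finset E), Finsupp.single (half u v) (midCoeff f u v) := by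
      intro u
      refine Finset.sum_subset hsub fun v _ hv => ?_
      rw [midCoeff_comm, midCoeff_eq_zero_left (fnn u) (Finsupp.notMem_support_iff.mp hv),
        Finsupp.single_zero]
    simp only [inner]
    refine Finset.sum_subset hsub fun u _ hu => Finset.sum_eq_zero fun v _ => ?_
    rw [midCoeff_eq_zero_left (fnn v) (Finsupp.notMem_support_iff.mp hu), Finsupp.single_zero]
  have dbl : ∀ (p : E) (r : ℝ), Finsupp.single p (2⁻¹ * r) + Finsupp.single p (2⁻¹ * r) =
      Finsupp.single p r := by
    intro p r
    rw [← Finsupp.single_add]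
    congr 1
    ring
  have cab : midCoeff f a b = 2⁻¹ * min (2 * x) (min (2 * y) (max 0 (1 - 2 * z))) := by
    rw [midCoeff, if_neg hab, fa, fb, show 2 * (x + y) - 1 = 1 - 2 * z by linarith]
  have cac : midCoeff f a c = 2⁻¹ * min (2 * x) (min (2 * z) (max 0 (1 - 2 * y))) := by
    rw [midCoeff, if_neg hac, fa, fc, show 2 * (x + z) - 1 = 1 - 2 * y by linarith]
  have cbc : midCoeff f b c = 2⁻¹ * min (2 * y) (min (2 * z) (max 0 (1 - 2 * x))) := by
    rw [midCoeff, if_neg hbc, fb, fc, show 2 * (y + z) - 1 = 1 - 2 * x by linarith]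
  have caa : midCoeff f a a = max 0 (2 * x - 1) := by rw [midCoeff, if_pos rfl, fa]
  have cbb : midCoeff f b b = max 0 (2 * y - 1) := by rw [midCoeff, if_pos rfl, fb]
  have ccc : midCoeff f c c = max 0 (2 * z - 1) := by rw [midCoeff, if_pos rfl, fc]
  have s3 : ∀ F : E → E →₀ ℝ, ∑ u ∈ ({a, b, c} : Finset E), F u = F a + F b + F c := by
    intro F
    rw [Finset.sum_insert (by simp [hab, hac]), Finset.sum_insert (by simpa using hbc),
      Finset.sum_singleton, add_assoc]
  rw [e]
  simp only [s3]
  rw [midCoeff_comm f b a, midCoeff_comm f c a, midCoeff_comm f c b, half_comm b a,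
    half_comm c a, half_comm c b, half_self, half_self, half_self, caa, cbb, ccc, cab, cac, cbc]
  rw [← dbl (half a b) (min (2 * x) _), ← dbl (half a c) (min (2 * x) _),
    ← dbl (half b c) (min (2 * y) _)]
  abel

lemma exists_parent_weight {t t' : E × E × E} (ht : TriNondeg t) (h' : t' ∈ triChildren t)
    {x y z : ℝ} (h : ConvWeight x y z) :
    ∃ x' y' z', ConvWeight x' y' z' ∧ triComb t x' y' z' = triComb t' x y z ∧
      midWeight (triWeight t x' y' z') = triWeight t' x y z := by
  obtain ⟨a, b, c⟩ := t
  obtain ⟨hab, hac, hbc⟩ := ht.distinct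
  obtain ⟨hx, hy, hz, hs⟩ := h
  simp only [triChildren, Set.mem_insert_iff, Set.mem_singleton_iff] at h'
  rcases h' with rfl | rfl | rfl | rfl
  · have hw : ConvWeight (x + y / 2 + z / 2) (y / 2) (z / 2) :=
      ⟨by positivity, by positivity, by positivity, by linarith⟩
    refine ⟨_, _, _, hw, by simp only [triComb, half]; module, ?_⟩
    rw [midWeight_triWeight hab hac hbc hw]
    have e1 : max 0 (2 * (x + y / 2 + z / 2) - 1) = x := by grind
    have e2 : max 0 (2 * (y / 2) - 1) = 0 := by grind
    have e3 : max 0 (2 * (z / 2) - 1) = 0 := by grind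
    have e4 : min (2 * (x + y / 2 + z / 2)) (min (2 * (y / 2)) (max 0 (1 - 2 * (z / 2)))) = y := by
      grind
    have e5 : min (2 * (x + y / 2 + z / 2)) (min (2 * (z / 2)) (max 0 (1 - 2 * (y / 2)))) = z := by
      grind
    have e6 : min (2 * (y / 2)) (min (2 * (z / 2)) (max 0 (1 - 2 * (x + y / 2 + z / 2)))) = 0 := by
      grind
    rw [e1, e2, e3, e4, e5, e6]
    simp [triWeight]
  · have hw : ConvWeight (x / 2) (y + x / 2 + z / 2) (z / 2) :=
      ⟨by positivity, by positivity, by positivity, by linarith⟩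
    refine ⟨_, _, _, hw, by simp only [triComb, half]; module, ?_⟩
    rw [midWeight_triWeight hab hac hbc hw]
    have e1 : max 0 (2 * (x / 2) - 1) = 0 := by grind
    have e2 : max 0 (2 * (y + x / 2 + z / 2) - 1) = y := by grind
    have e3 : max 0 (2 * (z / 2) - 1) = 0 := by grind
    have e4 : min (2 * (x / 2)) (min (2 * (y + x / 2 + z / 2)) (max 0 (1 - 2 * (z / 2)))) = x := by
      grind
    have e5 : min (2 * (x / 2)) (min (2 * (z / 2)) (max 0 (1 - 2 * (y + x / 2 + z / 2)))) = 0 := by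
      grind
    have e6 : min (2 * (y + x / 2 + z / 2)) (min (2 * (z / 2)) (max 0 (1 - 2 * (x / 2)))) = z := by
      grind
    rw [e1, e2, e3, e4, e5, e6]
    simp only [triWeight, Finsupp.single_zero]
    abel
  · have hw : ConvWeight (x / 2) (y / 2) (z + x / 2 + y / 2) :=
      ⟨by positivity, by positivity, by positivity, by linarith⟩
    refine ⟨_, _, _, hw, by simp only [triComb, half]; module, ?_⟩
    rw [midWeight_triWeight hab hac hbc hw]
    have e1 : max 0 (2 * (x / 2) - 1) = 0 := by grind
    have e2 : max 0 (2 * (y / 2) - 1) = 0 := by grind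
    have e3 : max 0 (2 * (z + x / 2 + y / 2) - 1) = z := by grind
    have e4 : min (2 * (x / 2)) (min (2 * (y / 2)) (max 0 (1 - 2 * (z + x / 2 + y / 2)))) = 0 := by
      grind
    have e5 : min (2 * (x / 2)) (min (2 * (z + x / 2 + y / 2)) (max 0 (1 - 2 * (y / 2)))) = x := by
      grind
    have e6 : min (2 * (y / 2)) (min (2 * (z + x / 2 + y / 2)) (max 0 (1 - 2 * (x / 2)))) = y := by
      grind
    rw [e1, e2, e3, e4, e5, e6]
    simp only [triWeight, Finsupp.single_zero]
    abel
  · have hw : ConvWeight ((y + z) / 2) ((x + z) / 2) ((x + y) / 2) :=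
      ⟨by positivity, by positivity, by positivity, by linarith⟩
    refine ⟨_, _, _, hw, by simp only [triComb, half]; module, ?_⟩
    rw [midWeight_triWeight hab hac hbc hw]
    have e1 : max 0 (2 * ((y + z) / 2) - 1) = 0 := by grind
    have e2 : max 0 (2 * ((x + z) / 2) - 1) = 0 := by grind
    have e3 : max 0 (2 * ((x + y) / 2) - 1) = 0 := by grind
    have e4 : min (2 * ((y + z) / 2)) (min (2 * ((x + z) / 2)) (max 0 (1 - 2 * ((x + y) / 2)))) =
        z := by grind
    have e5 : min (2 * ((y + z) / 2)) (min (2 * ((x + y) / 2)) (max 0 (1 - 2 * ((x + z) / 2)))) =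
        y := by grind
    have e6 : min (2 * ((x + z) / 2)) (min (2 * ((x + y) / 2)) (max 0 (1 - 2 * ((y + z) / 2)))) =
        x := by grind
    rw [e1, e2, e3, e4, e5, e6]
    simp only [triWeight, Finsupp.single_zero]
    abel

lemma exists_child_weight (t : E × E × E) {x y z : ℝ} (h : ConvWeight x y z) :
    ∃ t' ∈ triChildren t, ∃ x' y' z', ConvWeight x' y' z' ∧
      triComb t' x' y' z' = triComb t x y z := by
  obtain ⟨hx, hy, hz, hs⟩ := h
  by_cases h1 : 1 / 2 ≤ x
  · refine ⟨_, Or.inl rfl, 2 * x - 1, 2 * y, 2 * z,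
      ⟨by linarith, by linarith, by linarith, by linarith⟩, ?_⟩
    obtain rfl : x = 1 - y - z := by linarith
    simp only [triComb, half]; module
  by_cases h2 : 1 / 2 ≤ y
  · refine ⟨_, Or.inr (Or.inl rfl), 2 * x, 2 * y - 1, 2 * z,
      ⟨by linarith, by linarith, by linarith, by linarith⟩, ?_⟩
    obtain rfl : x = 1 - y - z := by linarith
    simp only [triComb, half]; module
  by_cases h3 : 1 / 2 ≤ z
  · refine ⟨_, Or.inr (Or.inr (Or.inl rfl)), 2 * x, 2 * y, 2 * z - 1,
      ⟨by linarith, by linarith, by linarith, by linarith⟩, ?_⟩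
    obtain rfl : x = 1 - y - z := by linarith
    simp only [triComb, half]; module
  · refine ⟨_, Or.inr (Or.inr (Or.inr rfl)), 1 - 2 * x, 1 - 2 * y, 1 - 2 * z,
      ⟨by linarith, by linarith, by linarith, by linarith⟩, ?_⟩
    obtain rfl : x = 1 - y - z := by linarith
    simp only [triComb, half]; module

lemma exists_homothetic_of_mem_triChildren {t t' : E × E × E} (h : t' ∈ triChildren t) :
    ∃ k : ℝ, |k| = 2⁻¹ ∧ TriHomothetic k t t' := by
  have h2 : |(2⁻¹ : ℝ)| = 2⁻¹ := abs_of_pos (by norm_num)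
  simp only [triChildren, Set.mem_insert_iff, Set.mem_singleton_iff] at h
  rcases h with rfl | rfl | rfl | rfl
  · exact ⟨2⁻¹, h2, by constructor <;> simp only [half] <;> module⟩
  · exact ⟨2⁻¹, h2, by constructor <;> simp only [half] <;> module⟩
  · exact ⟨2⁻¹, h2, by constructor <;> simp only [half] <;> module⟩
  · exact ⟨-2⁻¹, by rw [abs_neg, h2], by constructor <;> simp only [half] <;> module⟩

lemma IsTriFamily.triSubdivision {T : Set (E × E × E)} (hT : IsTriFamily T) :
    IsTriFamily (triSubdivision T) where
  finite := hT.finite.biUnion fun t _ => by simp [triChildren]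
  nondeg := by
    intro t' ht'
    obtain ⟨t, ht, h⟩ := Set.mem_iUnion₂.mp ht'
    obtain ⟨k, hk, hh⟩ := exists_homothetic_of_mem_triChildren h
    refine (hT.nondeg t ht).of_homothetic (fun h0 => ?_) hh
    rw [h0] at hk
    norm_num at hk
  weight_eq := by
    intro s hs s' hs' x y z x' y' z' h h' hc
    obtain ⟨t, ht, hst⟩ := Set.mem_iUnion₂.mp hs
    obtain ⟨t', ht', hst'⟩ := Set.mem_iUnion₂.mp hs'
    obtain ⟨a, b, c, hw, he, hm⟩ := exists_parent_weight (hT.nondeg t ht) hst h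
    obtain ⟨a', b', c', hw', he', hm'⟩ := exists_parent_weight (hT.nondeg t' ht') hst' h'
    rw [← hm, ← hm', hT.weight_eq t ht t' ht' _ _ _ _ _ _ hw hw' (by rw [he, he', hc])]

lemma IsTriFamily.triSpace_triSubdivision {T : Set (E × E × E)} (hT : IsTriFamily T) :
    triSpace (_root_.triSubdivision T) = triSpace T := by
  ext p
  constructor
  · rintro ⟨s, hs, x, y, z, h, rfl⟩
    obtain ⟨t, ht, hst⟩ := Set.mem_iUnion₂.mp hs
    obtain ⟨a, b, c, hw, he, -⟩ := exists_parent_weight (hT.nondeg t ht) hst h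
    exact ⟨t, ht, a, b, c, hw, he⟩
  · rintro ⟨t, ht, x, y, z, h, rfl⟩
    obtain ⟨s, hs, a, b, c, hw, he⟩ := exists_child_weight t h
    exact ⟨s, Set.mem_biUnion ht hs, a, b, c, hw, he⟩

lemma IsTriFamily.exists_iterated_subdivision {T : Set (E × E × E)} (hT : IsTriFamily T) (n : ℕ) :
    ∃ S : Set (E × E × E), IsTriFamily S ∧ triSpace S = triSpace T ∧
      ∀ s ∈ S, ∃ t ∈ T, ∃ k : ℝ, |k| = 2⁻¹ ^ n ∧ TriHomothetic k t s := by
  induction n with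
  | zero => exact ⟨T, hT, rfl, fun s hs => ⟨s, hs, 1, by simp, by simp [TriHomothetic]⟩⟩
  | succ n ih =>
    obtain ⟨S, hS, hsp, hh⟩ := ih
    refine ⟨_root_.triSubdivision S, hS.triSubdivision, hS.triSpace_triSubdivision.trans hsp, ?_⟩
    intro s' hs'
    obtain ⟨s, hs, h⟩ := Set.mem_iUnion₂.mp hs'
    obtain ⟨t, ht, k, hk, htk⟩ := hh s hs
    obtain ⟨l, hl, hsl⟩ := exists_homothetic_of_mem_triChildren h
    exact ⟨t, ht, l * k, by rw [abs_mul, hk, hl, pow_succ, mul_comm], htk.trans hsl⟩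

lemma rotate_mem_orderedTriangles {K : SimplicialComplex ℝ E} {a b c : E}
    (h : (a, b, c) ∈ orderedTriangles K) : (b, c, a) ∈ orderedTriangles K := by
  classical
  obtain ⟨hf, h1, h2, h3⟩ := h
  refine ⟨?_, h3, h1.symm, h2.symm⟩
  convert hf using 1
  ext v
  simp only [triVerts, Finset.mem_insert, Finset.mem_singleton]
  tauto

lemma swap_mem_orderedTriangles {K : SimplicialComplex ℝ E} {a b c : E}
    (h : (a, b, c) ∈ orderedTriangles K) : (a, c, b) ∈ orderedTriangles K := by
  classical
  obtain ⟨hf, h1, h2, h3⟩ := h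
  refine ⟨?_, h2, h1, h3.symm⟩
  convert hf using 1
  ext v
  simp only [triVerts, Finset.mem_insert, Finset.mem_singleton]
  tauto

lemma exists_homothetic_of_mem_triVerts {K : SimplicialComplex ℝ E} {k : ℝ} {s t : E × E × E}
    (ht : t ∈ orderedTriangles K) (h : TriHomothetic k t s) {p q r : E} (hp : p ∈ triVerts s)
    (hq : q ∈ triVerts s) (hr : r ∈ triVerts s) (hpq : p ≠ q) (hqr : q ≠ r) (hpr : p ≠ r) :
    ∃ t' ∈ orderedTriangles K, TriHomothetic k t' (p, q, r) := by
  classical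
  obtain ⟨a, b, c⟩ := t
  obtain ⟨x, y, z⟩ := s
  simp only [triVerts, Finset.mem_insert, Finset.mem_singleton] at hp hq hr
  have ht1 := rotate_mem_orderedTriangles ht
  have ht2 := rotate_mem_orderedTriangles ht1
  have h1 := h.rotate
  have h2 := h1.rotate
  rcases hp with rfl | rfl | rfl <;> rcases hq with rfl | rfl | rfl <;>
    rcases hr with rfl | rfl | rfl <;> first
    | exact absurd rfl hpq
    | exact absurd rfl hqr
    | exact absurd rfl hpr
    | exact ⟨_, ht, h⟩
    | exact ⟨_, ht1, h1⟩
    | exact ⟨_, ht2, h2⟩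
    | exact ⟨_, swap_mem_orderedTriangles ht, h.swap⟩
    | exact ⟨_, swap_mem_orderedTriangles ht1, h1.swap⟩
    | exact ⟨_, swap_mem_orderedTriangles ht2, h2.swap⟩

end Subdivision

lemma Set.Finite.exists_pos_forall_le {ι : Type*} {S : Set ι} (hS : S.Finite) (f : ι → ℝ)
    (hf : ∀ i ∈ S, 0 < f i) : ∃ c > 0, ∀ i ∈ S, c ≤ f i := by
  rcases S.eq_empty_or_nonempty with rfl | hne
  · exact ⟨1, one_pos, by simp⟩
  · obtain ⟨i, hi, h⟩ := Set.exists_min_image S f hS hne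
    exact ⟨f i, hf i hi, h⟩

lemma IsTriangulation.triSpace_orderedTriangles {K : SimplicialComplex ℝ E2} {Ω : Set E2}
    (hK : IsTriangulation K Ω) : triSpace (orderedTriangles K) = Ω := by
  classical
  rw [← hK.2.2.1]
  ext p
  rw [SimplicialComplex.mem_space_iff]
  constructor
  · rintro ⟨t, ht, x, y, z, h, rfl⟩
    exact ⟨triVerts t, ht.1, triComb_mem_convexHull t h⟩
  · rintro ⟨s, hs, hp⟩
    obtain ⟨t, ht, hst, hcard⟩ := hK.2.2.2 s hs
    obtain ⟨a, b, c, hab, hac, hbc, rfl⟩ := Finset.card_eq_three.mp hcard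
    have hverts : triVerts (a, b, c) = {a, b, c} := by ext; simp [triVerts]
    have hmem : (a, b, c) ∈ orderedTriangles K := ⟨hverts ▸ ht, hab, hac, hbc⟩
    obtain ⟨u, -, -, huc, hup⟩ := exists_weight_of_mem_convexHull
      (nondeg_of_mem_orderedTriangles hmem) (hverts ▸ hst) hp
    exact ⟨_, hmem, _, _, _, huc, hup⟩

lemma IsTriFamily.isTriangulation_complex {T : Set (E2 × E2 × E2)} (hT : IsTriFamily T) :
    IsTriangulation hT.complex (triSpace T) := by
  refine ⟨hT.complex_faces_finite, ?_, hT.complex_space, ?_⟩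
  · rintro s ⟨-, t, ht, hst⟩
    exact (Finset.card_le_card hst).trans (hT.nondeg t ht).card_triVerts.le
  · rintro s ⟨-, t, ht, hst⟩
    exact ⟨triVerts t, ⟨triVerts_nonempty t, t, ht, Finset.Subset.refl _⟩, hst,
      (hT.nondeg t ht).card_triVerts⟩

lemma TriNondeg.sin_angle_pos {t : E2 × E2 × E2} (ht : TriNondeg t) :
    0 < Real.sin (∠ t.1 t.2.1 t.2.2) := by
  apply EuclideanGeometry.sin_pos_of_not_collinear
  rw [← affineIndependent_iff_not_collinear_set, affineIndependent_iff_of_fintype]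
  intro w hw h0
  rw [Finset.univ.weightedVSub_eq_linear_combination hw] at h0
  simp only [Fin.sum_univ_three] at hw h0
  have := ht (w 0) (w 1) (w 2) hw (by simpa [triComb] using h0)
  intro i
  fin_cases i
  · exact this.1
  · exact this.2.1
  · exact this.2.2

lemma TriHomothetic.angle_eq {k : ℝ} (hk : k ≠ 0) {t t' : E2 × E2 × E2}
    (h : TriHomothetic k t t') : ∠ t'.1 t'.2.1 t'.2.2 = ∠ t.1 t.2.1 t.2.2 := by
  obtain ⟨h1, h2⟩ := h
  unfold EuclideanGeometry.angle
  have e1 : t'.1 -ᵥ t'.2.1 = k • (t.1 -ᵥ t.2.1) := by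
    rw [vsub_eq_sub, vsub_eq_sub, ← neg_sub, h1]; module
  have e2 : t'.2.2 -ᵥ t'.2.1 = k • (t.2.2 -ᵥ t.2.1) := by
    rw [vsub_eq_sub, vsub_eq_sub, ← sub_sub_sub_cancel_right _ _ t'.1, h1, h2]; module
  rw [e1, e2, InnerProductGeometry.angle_smul_smul hk]

lemma TriHomothetic.dist_eq {k : ℝ} {t t' : E2 × E2 × E2} (h : TriHomothetic k t t') :
    dist t'.1 t'.2.1 = |k| * dist t.1 t.2.1 := by
  rw [dist_comm, dist_eq_norm, h.1, norm_smul, Real.norm_eq_abs, dist_comm, dist_eq_norm]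

lemma exists_angle_sin_le {c : ℝ} (hc : 0 < c) :
    ∃ θ : ℝ, 0 < θ ∧ θ ≤ π / 3 ∧ Real.sin θ ≤ c := by
  have hpi := Real.pi_pos
  refine ⟨min (π / 3) c, lt_min (by linarith) hc, min_le_left _ _, ?_⟩
  exact (Real.sin_le (lt_min (by linarith) hc).le).trans (min_le_right _ _)

/-- existence of arbitrarily fine quasiuniform triangulations of a
closed polygon. -/
theorem statement16 (Ω : Set E2) (hΩ : IsClosedPolygon Ω) :
    ∃ ε₀ > (0 : ℝ), ∃ θ : ℝ, 0 < θ ∧ θ ≤ π / 3 ∧ ∃ d : ℝ, 0 < d ∧ d < 1 ∧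
      ∀ ε : ℝ, 0 < ε → ε ≤ ε₀ →
        ∃ L : SimplicialComplex ℝ E2, IsTriangulation L Ω ∧
          AngleLB L (Real.sin θ) ∧
          ∀ e ∈ L.faces, e.card = 2 → d * ε ≤ edgeLen e ∧ edgeLen e ≤ ε := by
  classical
  obtain ⟨-, K, hK⟩ := hΩ
  have hT := isTriFamily_orderedTriangles hK.1
  obtain ⟨c, hc, hcle⟩ := hT.finite.exists_pos_forall_le
    (fun t => Real.sin (∠ t.1 t.2.1 t.2.2)) (fun t ht => (hT.nondeg t ht).sin_angle_pos)
  obtain ⟨l, hl, hle⟩ := hT.finite.exists_pos_forall_le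
    (fun t => dist t.1 t.2.1) (fun t ht => dist_pos.mpr ht.2.1)
  obtain ⟨M₀, hM₀⟩ := (hT.finite.image fun t => dist t.1 t.2.1).bddAbove
  obtain ⟨θ, hθ, hθ3, hθc⟩ := exists_angle_sin_le hc
  have hlM : l ≤ max M₀ l := le_max_right _ _
  have hMle : ∀ t ∈ orderedTriangles K, dist t.1 t.2.1 ≤ max M₀ l := fun t ht =>
    (hM₀ (Set.mem_image_of_mem _ ht)).trans (le_max_left _ _)
  set M := max M₀ l
  have hM : 0 < M := hl.trans_le hlM
  refine ⟨M, hM, θ, hθ, hθ3, l / (2 * M), by positivity,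
    by rw [div_lt_one (by positivity)]; linarith, ?_⟩
  intro ε hε hεM
  obtain ⟨n, hn1, hn2⟩ := exists_nat_pow_near ((one_le_div hε).mpr hεM) (one_lt_two (α := ℝ))
  obtain ⟨S, hS, hsp, hh⟩ := hT.exists_iterated_subdivision (n + 1)
  refine ⟨hS.complex, ?_, ?_, ?_⟩
  · have := hS.isTriangulation_complex
    rwa [hsp, hK.triSpace_orderedTriangles] at this
  · rintro s ⟨-, t', ht', hst⟩ p hp q hq r hr hpq hqr hpr
    obtain ⟨t, ht, k, hk, htk⟩ := hh t' ht'
    have hk0 : k ≠ 0 := abs_pos.mp (by rw [hk]; positivity)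
    obtain ⟨t₁, ht₁, h₁⟩ := exists_homothetic_of_mem_triVerts ht htk (hst hp) (hst hq) (hst hr)
      hpq hqr hpr
    have := h₁.angle_eq hk0
    simp only at this
    rw [this]
    exact hθc.trans (hcle t₁ ht₁)
  · rintro e ⟨-, t', ht', het⟩ hcard
    obtain ⟨t, ht, k, hk, htk⟩ := hh t' ht'
    obtain ⟨p, q, hpq, rfl⟩ := Finset.card_eq_two.mp hcard
    obtain ⟨r, hr, hrn⟩ : ∃ r ∈ triVerts t', r ∉ ({p, q} : Finset E2) :=
      Finset.exists_mem_notMem_of_card_lt_card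
        (by rw [hcard, (hS.nondeg t' ht').card_triVerts]; norm_num)
    simp only [Finset.mem_insert, Finset.mem_singleton, not_or] at hrn
    obtain ⟨t₁, ht₁, h₁⟩ := exists_homothetic_of_mem_triVerts ht htk
      (het (by simp)) (het (by simp)) hr hpq (Ne.symm hrn.2) (Ne.symm hrn.1)
    have hd := h₁.dist_eq
    simp only at hd
    have hedge : edgeLen {p, q} = 2⁻¹ ^ (n + 1) * dist t₁.1 t₁.2.1 := by
      rw [edgeLen, Finset.coe_pair, Metric.diam_pair, hd, hk]
    rw [hedge, inv_pow, inv_mul_eq_div]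
    have hpow : (0 : ℝ) < 2 ^ (n + 1) := by positivity
    have h1 := hle t₁ ht₁
    have h2 := hMle t₁ ht₁
    rw [le_div_iff₀ hε] at hn1
    rw [div_lt_iff₀ hε] at hn2
    constructor
    · rw [le_div_iff₀ hpow, div_mul_eq_mul_div, div_mul_eq_mul_div, div_le_iff₀ (by positivity)]
      have h3 : ε * 2 ^ (n + 1) ≤ 2 * M := by rw [pow_succ]; linarith
      nlinarith [mul_le_mul h1 h3 (by positivity) (hl.le.trans h1)]
    · rw [div_le_iff₀ hpow]
      linarith

end
end

section
/- Let 0 < α < 1 and let Ω := [−1, 1] × [−1, 1] ⊂ ℝ². Define h : Ω → ℝ² by h(x, y) := (|x|^α · sgn x, y). Then h is a homeomorphism onto its image with |h|_α < ∞, its inverse is Lipschitz continuous on h(Ω), and h cannot be approximated by Lipschitz maps in the α-Hölder seminorm: there exists δ > 0 such that every Lipschitz function f : Ω → ℝ² satisfies |f − h|_α ≥ δ. -/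
open Set Geometry EuclideanGeometry Metric Real

noncomputable section

/-- The Euclidean norm on the plane is bounded by the sum of the absolute coordinates. -/
lemma norm_le_abs_add_abs (x : E2) : ‖x‖ ≤ |x 0| + |x 1| := by
  rw [EuclideanSpace.norm_eq, Fin.sum_univ_two, Real.sqrt_le_left (by positivity)]
  simp only [Real.norm_eq_abs]
  nlinarith [mul_nonneg (abs_nonneg (x 0)) (abs_nonneg (x 1))]

lemma abs_apply_le_norm (x : E2) (i : Fin 2) : |x i| ≤ ‖x‖ :=
  PiLp.norm_apply_le x i

/-- The odd extension of `t ↦ t ^ α` to the real line. -/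
def signedPow (α t : ℝ) : ℝ := |t| ^ α * Real.sign t

lemma signedPow_of_nonneg {α t : ℝ} (hα : 0 < α) (ht : 0 ≤ t) : signedPow α t = t ^ α := by
  rcases ht.eq_or_lt with rfl | ht
  · simp [signedPow, Real.zero_rpow hα.ne']
  · simp [signedPow, Real.sign_of_pos ht, abs_of_pos ht]

lemma signedPow_neg (α t : ℝ) : signedPow α (-t) = -signedPow α t := by
  simp [signedPow, Real.sign_neg]

lemma signedPow_of_nonpos {α t : ℝ} (hα : 0 < α) (ht : t ≤ 0) :
    signedPow α t = -(-t) ^ α := by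
  rw [← signedPow_of_nonneg hα (neg_nonneg.2 ht), signedPow_neg, neg_neg]

lemma rpow_sub_rpow_le {α s t : ℝ} (hα0 : 0 < α) (hα1 : α ≤ 1) (ht : 0 ≤ t) (hts : t ≤ s) :
    s ^ α - t ^ α ≤ (s - t) ^ α := by
  have h := Real.rpow_add_le_add_rpow (sub_nonneg.2 hts) ht hα0.le hα1
  rw [sub_add_cancel] at h
  linarith

lemma mul_sub_le_rpow_sub_rpow {α s t : ℝ} (hα0 : 0 < α) (hα1 : α ≤ 1) (ht : 0 ≤ t)
    (hts : t ≤ s) (hs : s ≤ 1) : α * (s - t) ≤ s ^ α - t ^ α := by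
  rcases (ht.trans hts).eq_or_lt with h0 | h0
  · obtain rfl : t = s := by linarith
    simp
  have bernoulli := rpow_one_add_le_one_add_mul_self (s := t / s - 1)
    (by have := div_nonneg ht h0.le; linarith) hα0.le hα1
  rw [add_sub_cancel, Real.div_rpow ht h0.le, div_le_iff₀ (by positivity)] at bernoulli
  have hss : s ≤ s ^ α := Real.self_le_rpow_of_le_one h0.le hs hα1
  have hr : 0 ≤ α * (1 - t / s) :=
    mul_nonneg hα0.le (sub_nonneg.2 ((div_le_one h0).2 hts))
  have hmul := mul_le_mul_of_nonneg_left hss hr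
  have heq : α * (1 - t / s) * s = α * (s - t) := by field_simp
  linarith

lemma abs_signedPow_sub_le {α : ℝ} (hα0 : 0 < α) (hα1 : α ≤ 1) (s t : ℝ) :
    |signedPow α s - signedPow α t| ≤ 2 * |s - t| ^ α := by
  wlog hts : t ≤ s generalizing s t
  · rw [abs_sub_comm, abs_sub_comm s]
    exact this t s (le_of_not_ge hts)
  have hd : 0 ≤ (s - t) ^ α := Real.rpow_nonneg (sub_nonneg.2 hts) α
  rw [abs_of_nonneg (sub_nonneg.2 hts)]
  rcases le_total 0 t with ht | ht
  · rw [signedPow_of_nonneg hα0 ht, signedPow_of_nonneg hα0 (ht.trans hts),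
      abs_of_nonneg (sub_nonneg.2 (Real.rpow_le_rpow ht hts hα0.le))]
    linarith [rpow_sub_rpow_le hα0 hα1 ht hts]
  rcases le_total 0 s with hs | hs
  · rw [signedPow_of_nonneg hα0 hs, signedPow_of_nonpos hα0 ht, sub_neg_eq_add,
      abs_of_nonneg (add_nonneg (Real.rpow_nonneg hs α)
        (Real.rpow_nonneg (neg_nonneg.2 ht) α))]
    have h1 : s ^ α ≤ (s - t) ^ α := Real.rpow_le_rpow hs (by linarith) hα0.le
    have h2 : (-t) ^ α ≤ (s - t) ^ α :=
      Real.rpow_le_rpow (neg_nonneg.2 ht) (by linarith) hα0.le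
    linarith
  · have hst : -s ≤ -t := neg_le_neg hts
    rw [signedPow_of_nonpos hα0 hs, signedPow_of_nonpos hα0 ht, neg_sub_neg,
      abs_of_nonneg (sub_nonneg.2 (Real.rpow_le_rpow (neg_nonneg.2 hs) hst hα0.le))]
    have h := rpow_sub_rpow_le hα0 hα1 (neg_nonneg.2 hs) hst
    rw [neg_sub_neg] at h
    linarith

lemma mul_abs_sub_le_abs_signedPow_sub {α : ℝ} (hα0 : 0 < α) (hα1 : α ≤ 1) {s t : ℝ}
    (hs : s ∈ Set.Icc (-1 : ℝ) 1) (ht : t ∈ Set.Icc (-1 : ℝ) 1) :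
    α * |s - t| ≤ |signedPow α s - signedPow α t| := by
  wlog hts : t ≤ s generalizing s t
  · rw [abs_sub_comm, abs_sub_comm (signedPow α s)]
    exact this ht hs (le_of_not_ge hts)
  rw [abs_of_nonneg (sub_nonneg.2 hts)]
  refine le_trans ?_ (le_abs_self _)
  rcases le_total 0 t with ht0 | ht0
  · rw [signedPow_of_nonneg hα0 ht0, signedPow_of_nonneg hα0 (ht0.trans hts)]
    exact mul_sub_le_rpow_sub_rpow hα0 hα1 ht0 hts hs.2
  rcases le_total 0 s with hs0 | hs0
  · rw [signedPow_of_nonneg hα0 hs0, signedPow_of_nonpos hα0 ht0, sub_neg_eq_add]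
    have h1 : s ≤ s ^ α := Real.self_le_rpow_of_le_one hs0 hs.2 hα1
    have h2 : -t ≤ (-t) ^ α :=
      Real.self_le_rpow_of_le_one (neg_nonneg.2 ht0) (by linarith [ht.1]) hα1
    have h3 : α * (s - t) ≤ s - t := mul_le_of_le_one_left (sub_nonneg.2 hts) hα1
    linarith
  · rw [signedPow_of_nonpos hα0 hs0, signedPow_of_nonpos hα0 ht0, neg_sub_neg]
    have h := mul_sub_le_rpow_sub_rpow hα0 hα1 (neg_nonneg.2 hs0) (neg_le_neg hts)
      (by linarith [ht.1])
    rwa [neg_sub_neg] at h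

lemma le_two_mul_rpow {α d : ℝ} (hα0 : 0 < α) (hα1 : α ≤ 1) (hd0 : 0 ≤ d) (hd : d ≤ 2) :
    d ≤ 2 * d ^ α := by
  have h1 : d / 2 ≤ (d / 2) ^ α :=
    Real.self_le_rpow_of_le_one (by linarith) (by linarith) hα1
  have h2 : (d / 2) ^ α ≤ d ^ α := Real.rpow_le_rpow (by linarith) (by linarith) hα0.le
  linarith

lemma bddAbove_holderRatioSet {α C : ℝ} {S : Set E2} {u : E2 → E2}
    (hu : ∀ x ∈ S, ∀ y ∈ S, ‖u x - u y‖ ≤ C * ‖x - y‖ ^ α) :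
    BddAbove (holderRatioSet α S u) := by
  refine ⟨C, ?_⟩
  rintro _ ⟨x, hx, y, hy, hxy, rfl⟩
  rw [div_le_iff₀ (Real.rpow_pos_of_pos (norm_pos_iff.2 (sub_ne_zero.2 hxy)) α)]
  exact hu x hx y hy

lemma continuousOn_of_norm_sub_le_rpow {α C : ℝ} (hα : 0 < α) {S : Set E2} {u : E2 → E2}
    (hu : ∀ x ∈ S, ∀ y ∈ S, ‖u x - u y‖ ≤ C * ‖x - y‖ ^ α) : ContinuousOn u S := by
  intro y hy
  rw [ContinuousWithinAt, tendsto_iff_norm_sub_tendsto_zero]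
  have hlim : Filter.Tendsto (fun x => C * ‖x - y‖ ^ α) (nhdsWithin y S) (nhds 0) := by
    have hc : Continuous fun x : E2 => C * ‖x - y‖ ^ α :=
      continuous_const.mul
        ((continuous_id.sub continuous_const).norm.rpow_const fun _ => Or.inr hα.le)
    simpa [Real.zero_rpow hα.ne'] using (hc.tendsto y).mono_left nhdsWithin_le_nhds
  refine squeeze_zero' (Filter.Eventually.of_forall fun _ => norm_nonneg _) ?_ hlim
  filter_upwards [self_mem_nhdsWithin] with x hx using hu x hx y hy

/-- If `1 - L * t ^ (1 - α) ≤ C` for all small positive `t`, in the form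
`t ^ α - L * t ≤ C * t ^ α`, then `1 ≤ C`. -/
lemma one_le_of_rpow_sub_le {α L C : ℝ} (hα : α < 1)
    (h : ∀ t ∈ Set.Ioc (0 : ℝ) 1, t ^ α - L * t ≤ C * t ^ α) : 1 ≤ C := by
  have hlim : Filter.Tendsto (fun t : ℝ => 1 - L * t ^ (1 - α)) (nhdsWithin 0 (Set.Ioi 0))
      (nhds 1) := by
    have hc : Continuous fun t : ℝ => 1 - L * t ^ (1 - α) :=
      continuous_const.sub
        (continuous_const.mul (Real.continuous_rpow_const (sub_nonneg.2 hα.le)))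
    simpa [Real.zero_rpow (sub_pos.2 hα).ne'] using (hc.tendsto 0).mono_left nhdsWithin_le_nhds
  refine le_of_tendsto hlim ?_
  filter_upwards [Ioc_mem_nhdsGT zero_lt_one] with t ht
  have hpos : 0 < t ^ α := Real.rpow_pos_of_pos ht.1 α
  have hmul : t ^ (1 - α) * t ^ α = t := by
    rw [← Real.rpow_add ht.1, sub_add_cancel, Real.rpow_one]
  refine le_of_mul_le_mul_right ?_ hpos
  rw [sub_mul, one_mul, mul_assoc, hmul]
  exact h t ht

/-- the bi-Hölder homeomorphism `h(x,y) = (|x|^α sgn x, y)` on the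
square cannot be approximated by Lipschitz maps in the `α`-Hölder seminorm. -/
theorem statement17 (α : ℝ) (hα0 : 0 < α) (hα1 : α < 1)
    (Ω : Set E2)
    (hΩ : Ω = {x : E2 | x 0 ∈ Set.Icc (-1 : ℝ) 1 ∧ x 1 ∈ Set.Icc (-1 : ℝ) 1})
    (h : E2 → E2)
    (hh : ∀ x : E2, h x 0 = |x 0| ^ α * Real.sign (x 0) ∧ h x 1 = x 1) :
    IsHomeoOn h Ω ∧
    BddAbove (holderRatioSet α Ω h) ∧
    BddAbove (holderRatioSet 1 (h '' Ω) (Function.invFunOn h Ω)) ∧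
    ∃ δ > (0 : ℝ), ∀ f : E2 → E2, BddAbove (holderRatioSet 1 Ω f) →
      ∀ C : ℝ,
        (∀ x ∈ Ω, ∀ y ∈ Ω, ‖(f x - h x) - (f y - h y)‖ ≤ C * ‖x - y‖ ^ α) →
        δ ≤ C := by
  subst hΩ
  set Ω : Set E2 := {x : E2 | x 0 ∈ Set.Icc (-1 : ℝ) 1 ∧ x 1 ∈ Set.Icc (-1 : ℝ) 1}
  have h0 : ∀ x, h x 0 = signedPow α (x 0) := fun x => (hh x).1
  have h1 : ∀ x, h x 1 = x 1 := fun x => (hh x).2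
  have holder : ∀ x ∈ Ω, ∀ y ∈ Ω, ‖h x - h y‖ ≤ 4 * ‖x - y‖ ^ α := by
    intro x hx y hy
    have hsum := norm_le_abs_add_abs (h x - h y)
    simp only [PiLp.sub_apply, h0, h1] at hsum
    have hb0 := abs_signedPow_sub_le hα0 hα1.le (x 0) (y 0)
    have hb1 := le_two_mul_rpow hα0 hα1.le (abs_nonneg (x 1 - y 1))
      (abs_le.2 ⟨by linarith [hx.2.1, hy.2.2], by linarith [hx.2.2, hy.2.1]⟩)
    have hm (i : Fin 2) : |x i - y i| ^ α ≤ ‖x - y‖ ^ α :=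
      Real.rpow_le_rpow (abs_nonneg _) (abs_apply_le_norm (x - y) i) hα0.le
    linarith [hm 0, hm 1]
  have expand : ∀ x ∈ Ω, ∀ y ∈ Ω, ‖x - y‖ ≤ (1 / α + 1) * ‖h x - h y‖ := by
    intro x hx y hy
    have hsum := norm_le_abs_add_abs (x - y)
    have hc0 := abs_apply_le_norm (h x - h y) 0
    have hc1 := abs_apply_le_norm (h x - h y) 1
    simp only [PiLp.sub_apply, h0, h1] at hsum hc0 hc1
    have hb : |x 0 - y 0| ≤ 1 / α * ‖h x - h y‖ := by
      rw [one_div, ← div_eq_inv_mul, le_div_iff₀' hα0]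
      exact (mul_abs_sub_le_abs_signedPow_sub hα0 hα1.le hx.1 hy.1).trans hc0
    linarith
  have inj : Set.InjOn h Ω := by
    intro x hx y hy hxy
    have := expand x hx y hy
    rwa [hxy, sub_self, norm_zero, mul_zero, norm_le_zero_iff, sub_eq_zero] at this
  have inverse : ∀ u ∈ h '' Ω, ∀ v ∈ h '' Ω,
      ‖Function.invFunOn h Ω u - Function.invFunOn h Ω v‖
        ≤ (1 / α + 1) * ‖u - v‖ ^ (1 : ℝ) := by
    rintro _ ⟨x, hx, rfl⟩ _ ⟨y, hy, rfl⟩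
    rw [inj.leftInvOn_invFunOn hx, inj.leftInvOn_invFunOn hy, Real.rpow_one]
    exact expand x hx y hy
  refine ⟨⟨continuousOn_of_norm_sub_le_rpow hα0 holder, inj,
    continuousOn_of_norm_sub_le_rpow one_pos inverse⟩, bddAbove_holderRatioSet holder,
    bddAbove_holderRatioSet inverse, 1, one_pos, ?_⟩
  rintro f ⟨L, hL⟩ C hC
  refine one_le_of_rpow_sub_le (L := L) hα1 fun t ht => ?_
  set p : E2 := !₂[t, 0]
  have hp : p ∈ Ω := by
    simp [Ω, p]
    constructor <;> linarith [ht.1, ht.2]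
  have h0mem : (0 : E2) ∈ Ω := by simp [Ω]
  have hnorm : ‖p - 0‖ = t := by
    simp [p, EuclideanSpace.norm_eq, Real.sqrt_sq_eq_abs, abs_of_pos ht.1]
  have hne : p ≠ 0 := by
    rintro h'
    rw [h', sub_self, norm_zero] at hnorm
    exact ht.1.ne hnorm
  have hfp : ‖f p - f 0‖ ≤ L * t := by
    have := hL ⟨p, hp, 0, h0mem, hne, rfl⟩
    rwa [hnorm, Real.rpow_one, div_le_iff₀ ht.1] at this
  have hhp : t ^ α ≤ ‖h p - h 0‖ := by
    have := (le_abs_self _).trans (abs_apply_le_norm (h p - h 0) 0)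
    rw [PiLp.sub_apply, h0, h0, PiLp.zero_apply, signedPow_of_nonneg hα0 le_rfl,
      Real.zero_rpow hα0.ne', sub_zero] at this
    rwa [show p 0 = t from rfl, signedPow_of_nonneg hα0 ht.1.le] at this
  have hCp := hC p hp 0 h0mem
  rw [hnorm, sub_sub_sub_comm, norm_sub_rev] at hCp
  linarith [norm_sub_norm_le (h p - h 0) (f p - f 0)]

end
end
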